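/- In the Bruhat order on a Coxeter group, if u ∈ W^J and w' ≥ u with parabolic factorization w' = u'·x' (u' ∈ W^J, x' ∈ W_J), then u' ≥ u; more generally, the projection P^J : W → W^J sending w to its minimal-coset-representative factor is order-preserving for Bruhat order. -/

import Mathlib

/-- The Bruhat order on a Coxeter group, via the subword property. -/
def BruhatLE {B W : Type*} [Group W] {M : CoxeterMatrix B} (cs : CoxeterSystem M W)
    (u w : W) : Prop :=
  ∃ l : List B, cs.IsReduced l ∧ cs.wordProd l = w ∧
    ∃ l' : List B, l'.Sublist l ∧ cs.wordProd l' = u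

namespace CoxeterSystem

variable {B W : Type*} [Group W] {M : CoxeterMatrix B} (cs : CoxeterSystem M W)

open Classical in
/-- The action of the simple reflection `s i` on pairs (group element, parity): conjugate the
element, and flip the parity if the element is `s i` itself. -/
noncomputable def signedConj (i : B) : Function.End (W × ZMod 2) :=
  fun p => (cs.simple i * p.1 * cs.simple i, p.2 + if p.1 = cs.simple i then 1 else 0)

open Classical in
theorem signedConj_mul_pow_apply (i j : B) (k : ℕ) (p : W × ZMod 2) :
    ((cs.signedConj i * cs.signedConj j) ^ k) p =
      ((cs.simple i * cs.simple j) ^ k * p.1 * (cs.simple j * cs.simple i) ^ k,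
        p.2 + ∑ n ∈ Finset.range (2 * k),
          if p.1 = (cs.simple j * cs.simple i) ^ n * cs.simple j then 1 else 0) := by
  induction k with
  | zero => simp; rfl
  | succ k ih =>
    have hinv : ((cs.simple i * cs.simple j) ^ k)⁻¹ = (cs.simple j * cs.simple i) ^ k := by
      rw [← inv_pow, mul_inv_rev, inv_simple, inv_simple]
    have hshift : ∀ n : ℕ, (cs.simple j * cs.simple i) ^ n * cs.simple j =
        cs.simple j * (cs.simple i * cs.simple j) ^ n := by
      intro n
      induction n with
      | zero => simp
      | succ n ihn => rw [pow_succ', mul_assoc, ihn, pow_succ']; simp only [mul_assoc]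
    have hj : (cs.simple i * cs.simple j) ^ k * p.1 * (cs.simple j * cs.simple i) ^ k =
        cs.simple j ↔ p.1 = (cs.simple j * cs.simple i) ^ (2 * k) * cs.simple j := by
      rw [← hinv, mul_inv_eq_iff_eq_mul, ← eq_inv_mul_iff_mul_eq, hinv, ← hshift, two_mul,
        pow_add, mul_assoc]
    have hi : cs.simple j * ((cs.simple i * cs.simple j) ^ k * p.1 *
        (cs.simple j * cs.simple i) ^ k) * cs.simple j = cs.simple i ↔
        p.1 = (cs.simple j * cs.simple i) ^ (2 * k + 1) * cs.simple j := by
      have hexp : (cs.simple j * cs.simple i) ^ (2 * k + 1) * cs.simple j =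
          (cs.simple j * cs.simple i) ^ k * (cs.simple j * cs.simple i * cs.simple j *
            (cs.simple i * cs.simple j) ^ k) := by
        rw [mul_assoc _ (cs.simple j) (_ ^ k), ← hshift, two_mul, add_assoc, pow_add, pow_succ']
        simp only [mul_assoc]
      rw [hexp, ← hinv, eq_inv_mul_iff_mul_eq, ← mul_inv_eq_iff_eq_mul]
      have hcancel : cs.simple i = cs.simple j * (cs.simple j * cs.simple i * cs.simple j) *
          cs.simple j := by simp [mul_assoc]
      nth_rw 3 [hcancel]
      rw [mul_left_inj, mul_right_inj]
    rw [pow_succ']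
    change cs.signedConj i (cs.signedConj j (((cs.signedConj i * cs.signedConj j) ^ k) p)) = _
    rw [ih]
    simp only [signedConj, hj, hi]
    rw [show 2 * (k + 1) = 2 * k + 1 + 1 by ring, Finset.sum_range_succ, Finset.sum_range_succ,
      pow_succ' _ k, pow_succ _ k]
    simp only [mul_assoc, add_assoc]

theorem isLiftable_signedConj : M.IsLiftable cs.signedConj := by
  classical
  intro i j
  funext p
  rw [signedConj_mul_pow_apply, simple_mul_simple_pow, simple_mul_simple_pow', two_mul,
    Finset.sum_range_add]
  simp only [pow_add, simple_mul_simple_pow', one_mul, mul_one, CharTwo.add_self_eq_zero, add_zero]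
  rfl

/-- The action of `W` on pairs (group element, parity) extending `signedConj`. -/
noncomputable def signedConjHom : W →* Function.End (W × ZMod 2) :=
  cs.lift ⟨cs.signedConj, cs.isLiftable_signedConj⟩

open Classical in
theorem signedConjHom_wordProd (ω : List B) (p : W × ZMod 2) :
    cs.signedConjHom (cs.wordProd ω) p =
      (cs.wordProd ω * p.1 * (cs.wordProd ω)⁻¹, p.2 + ((cs.rightInvSeq ω).count p.1 : ZMod 2)) := by
  induction ω with
  | nil => simp; rfl
  | cons i ω ih =>
    rw [wordProd_cons, map_mul]
    change cs.signedConjHom (cs.simple i) (cs.signedConjHom (cs.wordProd ω) p) = _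
    have hs : cs.signedConjHom (cs.simple i) = cs.signedConj i :=
      cs.lift_apply_simple cs.isLiftable_signedConj i
    have hiff : cs.wordProd ω * p.1 * (cs.wordProd ω)⁻¹ = cs.simple i ↔
        (cs.wordProd ω)⁻¹ * cs.simple i * cs.wordProd ω = p.1 := by
      rw [mul_inv_eq_iff_eq_mul, ← eq_inv_mul_iff_mul_eq, eq_comm, mul_assoc]
    rw [ih, hs]
    simp only [signedConj, hiff]
    simp only [rightInvSeq, List.count_cons, beq_iff_eq, mul_inv_rev, inv_simple,
      mul_assoc, Nat.cast_add, Nat.cast_ite, Nat.cast_one, Nat.cast_zero, add_assoc]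

/-- The parity of the number of occurrences of `t` in the right inversion sequence of any word
for `w`. -/
noncomputable def inversionParity (w t : W) : ZMod 2 := (cs.signedConjHom w (t, 0)).2

theorem signedConjHom_apply (w : W) (p : W × ZMod 2) :
    cs.signedConjHom w p = (w * p.1 * w⁻¹, p.2 + cs.inversionParity w p.1) := by
  obtain ⟨ω, rfl⟩ := cs.wordProd_surjective w
  simp [inversionParity, signedConjHom_wordProd]

theorem inversionParity_mul (v w t : W) :
    cs.inversionParity (v * w) t =
      cs.inversionParity w t + cs.inversionParity v (w * t * w⁻¹) := by
  have h : cs.signedConjHom (v * w) (t, 0) = cs.signedConjHom v (cs.signedConjHom w (t, 0)) := by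
    rw [map_mul]; rfl
  simp only [signedConjHom_apply, zero_add] at h
  exact (Prod.ext_iff.mp h).2

theorem inversionParity_simple_self (i : B) :
    cs.inversionParity (cs.simple i) (cs.simple i) = 1 := by
  classical
  have h := cs.signedConjHom_wordProd [i] (cs.simple i, 0)
  rw [wordProd_singleton] at h
  simp [inversionParity, h]

theorem IsReflection.inversionParity_self {t : W} (ht : cs.IsReflection t) :
    cs.inversionParity t t = 1 := by
  obtain ⟨v, i, rfl⟩ := ht
  have hone : cs.inversionParity (v * v⁻¹) (v * cs.simple i * v⁻¹) = 0 := by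
    rw [mul_inv_cancel, inversionParity, map_one]; rfl
  have hconj : v⁻¹ * (v * cs.simple i * v⁻¹) * v⁻¹⁻¹ = cs.simple i := by group
  rw [inversionParity_mul, hconj] at hone
  rw [inversionParity_mul, hconj, inversionParity_mul, inversionParity_simple_self,
    mul_inv_cancel_right, add_left_comm, hone, add_zero]

theorem mem_rightInvSeq_of_inversionParity_ne_zero {ω : List B} {t : W}
    (h : cs.inversionParity (cs.wordProd ω) t ≠ 0) : t ∈ cs.rightInvSeq ω := by
  classical
  by_contra hmem
  apply h
  simp [inversionParity, signedConjHom_wordProd, List.count_eq_zero_of_not_mem hmem]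

theorem mem_rightInvSeq_of_isRightInversion {ω : List B} {t : W}
    (h : cs.IsRightInversion (cs.wordProd ω) t) : t ∈ cs.rightInvSeq ω := by
  obtain ⟨ht, hlt⟩ := h
  apply cs.mem_rightInvSeq_of_inversionParity_ne_zero
  intro hzero
  obtain ⟨μ, hμ, hprod⟩ := cs.exists_isReduced (cs.wordProd ω * t)
  have hone : cs.inversionParity (cs.wordProd μ) t = 1 := by
    rw [← hprod, inversionParity_mul, ht.inversionParity_self, mul_inv_cancel_right, hzero,
      add_zero]
  have hinv := cs.isRightInversion_of_mem_rightInvSeq hμ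
    (cs.mem_rightInvSeq_of_inversionParity_ne_zero (hone ▸ one_ne_zero))
  have hgt := hinv.2
  rw [← hprod, mul_assoc, ht.mul_self, mul_one] at hgt
  exact lt_asymm hlt hgt

/-- The strong exchange property, for words which need not be reduced. -/
theorem exists_wordProd_mul_eq_eraseIdx {ω : List B} {t : W}
    (h : cs.IsRightInversion (cs.wordProd ω) t) :
    ∃ n < ω.length, cs.wordProd ω * t = cs.wordProd (ω.eraseIdx n) := by
  obtain ⟨n, hn, rfl⟩ := List.mem_iff_getElem.mp (cs.mem_rightInvSeq_of_isRightInversion h)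
  refine ⟨n, by simpa using hn, ?_⟩
  rw [← cs.wordProd_mul_getD_rightInvSeq, List.getD_eq_getElem _ _ hn]

theorem exists_sublist_wordProd_mul_simple {ω : List B} {i : B}
    (h : cs.IsRightDescent (cs.wordProd ω) i) :
    ∃ ω' : List B, ω'.Sublist ω ∧ ω'.length < ω.length ∧
      cs.wordProd ω' = cs.wordProd ω * cs.simple i := by
  obtain ⟨n, hn, heq⟩ := cs.exists_wordProd_mul_eq_eraseIdx
    ((cs.isRightInversion_simple_iff_isRightDescent _ i).mpr h)
  refine ⟨ω.eraseIdx n, List.eraseIdx_sublist _ _, ?_, heq.symm⟩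
  rw [List.length_eraseIdx_of_lt hn]
  omega

/-- The relation `v < w` of differing by a right multiplication by a reflection: the edges of the
Bruhat graph. -/
def BruhatEdge (v w : W) : Prop := ∃ t, cs.IsRightInversion w t ∧ v = w * t

theorem bruhatEdge_mul_simple {w : W} {i : B} (h : cs.IsRightDescent w i) :
    cs.BruhatEdge (w * cs.simple i) w :=
  ⟨_, (cs.isRightInversion_simple_iff_isRightDescent w i).mpr h, rfl⟩

/-- The reduced word obtained by appending a right descent. -/
theorem exists_isReduced_append_singleton {w : W} {i : B} (h : cs.IsRightDescent w i) :
    ∃ ω : List B, cs.IsReduced ω ∧ cs.wordProd ω = w * cs.simple i ∧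
      cs.IsReduced (ω ++ [i]) ∧ cs.wordProd (ω ++ [i]) = w := by
  obtain ⟨ω, hω, hprod⟩ := cs.exists_isReduced (w * cs.simple i)
  have hw : cs.wordProd (ω ++ [i]) = w := by
    rw [wordProd_append, wordProd_singleton, ← hprod, simple_mul_simple_cancel_right]
  refine ⟨ω, hω, hprod.symm, ?_, hw⟩
  rw [IsReduced, hw, List.length_append, List.length_singleton, ← hω.eq, ← hprod]
  exact (cs.isRightDescent_iff.mp h).symm

theorem BruhatEdge.mul_simple {v w : W} (h : cs.BruhatEdge v w) (i : B) :
    v * cs.simple i = w ∨ cs.BruhatEdge (v * cs.simple i) (w * cs.simple i) := by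
  obtain ⟨t, ht, rfl⟩ := h
  have hrefl : cs.IsReflection (cs.simple i * t * cs.simple i) := by
    simpa using ht.1.conj (cs.simple i)
  have heq : w * t * cs.simple i =
      w * cs.simple i * (cs.simple i * t * cs.simple i) := by
    simp [mul_assoc]
  have hedge (hlt : cs.length (w * t * cs.simple i) < cs.length (w * cs.simple i)) :
      cs.BruhatEdge (w * t * cs.simple i) (w * cs.simple i) :=
    ⟨_, ⟨hrefl, heq ▸ hlt⟩, heq⟩
  by_cases hd : cs.IsRightDescent w i
  · obtain ⟨ω, hω, hprod, -, hw⟩ := cs.exists_isReduced_append_singleton hd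
    obtain ⟨n, hn, hdel⟩ := cs.exists_wordProd_mul_eq_eraseIdx (hw.symm ▸ ht)
    rw [hw] at hdel
    rcases lt_or_ge n ω.length with hlt | hge
    · right
      apply hedge
      rw [hdel, List.eraseIdx_append_of_lt_length hlt, wordProd_append, wordProd_singleton,
        simple_mul_simple_cancel_right, ← hprod, hω.eq]
      refine (cs.length_wordProd_le _).trans_lt ?_
      rw [List.length_eraseIdx_of_lt hlt]
      omega
    · left
      have hn' : n = ω.length := by simp at hn; omega
      rw [hdel, hn', List.eraseIdx_append_of_length_le le_rfl]
      simp [hprod]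
  · right
    apply hedge
    have hlen := cs.not_isRightDescent_iff.mp hd
    have hle := cs.length_mul_le (w * t) (cs.simple i)
    rw [length_simple] at hle
    have := ht.2
    omega

theorem reflTransGen_bruhatEdge_mul_simple {v w : W}
    (h : Relation.ReflTransGen cs.BruhatEdge v w) {i : B} (hi : ¬ cs.IsRightDescent w i) :
    Relation.ReflTransGen cs.BruhatEdge (v * cs.simple i) (w * cs.simple i) := by
  have hup : cs.BruhatEdge w (w * cs.simple i) := by
    have hd : cs.IsRightDescent (w * cs.simple i) i := by
      rw [isRightDescent_iff_not_isRightDescent_mul, simple_mul_simple_cancel_right]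
      exact hi
    simpa using cs.bruhatEdge_mul_simple hd
  induction h using Relation.ReflTransGen.head_induction_on with
  | refl => exact .refl
  | head hedge hrest ih =>
    rcases hedge.mul_simple cs i with heq | hedge'
    · exact heq ▸ hrest.tail hup
    · exact ih.head hedge'

theorem reflTransGen_bruhatEdge_of_sublist {ω ω' : List B} (hω : cs.IsReduced ω)
    (h : ω'.Sublist ω) :
    Relation.ReflTransGen cs.BruhatEdge (cs.wordProd ω') (cs.wordProd ω) := by
  induction ω using List.reverseRecOn generalizing ω' with
  | nil => rw [List.sublist_nil.mp h]
  | append_singleton ω i ih =>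
    have hred : cs.IsReduced ω := by simpa using hω.take ω.length
    have hlen : ¬ cs.IsRightDescent (cs.wordProd ω) i := by
      have h1 := hω.eq
      rw [wordProd_append, wordProd_singleton, List.length_append, List.length_singleton] at h1
      rw [not_isRightDescent_iff, h1, hred.eq]
    obtain ⟨a, b, rfl, ha, hb⟩ := List.sublist_append_iff.mp h
    have hmul := cs.reflTransGen_bruhatEdge_mul_simple (ih hred ha) hlen
    rw [wordProd_append, wordProd_append, wordProd_singleton]
    rcases List.sublist_singleton.mp hb with rfl | rfl
    · rw [wordProd_nil, mul_one]
      refine (ih hred ha).tail ?_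
      simpa using cs.bruhatEdge_mul_simple (w := cs.wordProd ω * cs.simple i) (i := i) (by
        rw [isRightDescent_iff_not_isRightDescent_mul, simple_mul_simple_cancel_right]
        exact hlen)
    · rwa [wordProd_singleton]

theorem exists_sublist_of_reflTransGen_bruhatEdge {v w : W}
    (h : Relation.ReflTransGen cs.BruhatEdge v w) {ω : List B} (hω : cs.wordProd ω = w) :
    ∃ ω' : List B, ω'.Sublist ω ∧ cs.wordProd ω' = v := by
  induction h using Relation.ReflTransGen.head_induction_on with
  | refl => exact ⟨ω, List.Sublist.refl _, hω⟩
  | head hedge _ ih =>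
    obtain ⟨ω', hsub, rfl⟩ := ih
    obtain ⟨t, ht, rfl⟩ := hedge
    obtain ⟨n, -, heq⟩ := cs.exists_wordProd_mul_eq_eraseIdx ht
    exact ⟨ω'.eraseIdx n, (List.eraseIdx_sublist _ _).trans hsub, heq.symm⟩

end CoxeterSystem

namespace BruhatLE

variable {B W : Type*} [Group W] {M : CoxeterMatrix B} {cs : CoxeterSystem M W}

/-- The subword property: the Bruhat order can be tested on any word for the larger element. -/
theorem exists_sublist {v w : W} (h : BruhatLE cs v w) {ω : List B} (hω : cs.wordProd ω = w) :
    ∃ ω' : List B, ω'.Sublist ω ∧ cs.wordProd ω' = v := by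
  obtain ⟨l, hl, rfl, l', hsub, rfl⟩ := h
  exact cs.exists_sublist_of_reflTransGen_bruhatEdge
    (cs.reflTransGen_bruhatEdge_of_sublist hl hsub) hω

theorem mul_simple_left {v w : W} (h : BruhatLE cs v w) {i : B} (hi : cs.IsRightDescent v i) :
    BruhatLE cs (v * cs.simple i) w := by
  obtain ⟨l, hl, hw, l', hsub, rfl⟩ := h
  obtain ⟨l'', hsub', -, heq⟩ := cs.exists_sublist_wordProd_mul_simple hi
  exact ⟨l, hl, hw, l'', hsub'.trans hsub, heq⟩

/-- The lifting property of the Bruhat order. -/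
theorem mul_simple_right {v w : W} (h : BruhatLE cs v w) {i : B}
    (hv : ¬ cs.IsRightDescent v i) (hw : cs.IsRightDescent w i) :
    BruhatLE cs v (w * cs.simple i) := by
  obtain ⟨ω, hω, hprod, -, hωi⟩ := cs.exists_isReduced_append_singleton hw
  obtain ⟨ω', hsub, rfl⟩ := h.exists_sublist hωi
  refine ⟨ω, hω, hprod, ?_⟩
  obtain ⟨a, b, rfl, ha, hb⟩ := List.sublist_append_iff.mp hsub
  rcases List.sublist_singleton.mp hb with rfl | rfl
  · exact ⟨a, ha, by simp⟩
  · rw [cs.wordProd_append, cs.wordProd_singleton] at hv ⊢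
    rw [← cs.isRightDescent_iff_not_isRightDescent_mul] at hv
    obtain ⟨a', ha', -, heq⟩ := cs.exists_sublist_wordProd_mul_simple hv
    exact ⟨a', ha'.trans ha, heq⟩

end BruhatLE

namespace CoxeterSystem

variable {B W : Type*} [Group W] {M : CoxeterMatrix B} (cs : CoxeterSystem M W)

theorem exists_word_of_mem_closure {J : Set B} {x : W}
    (hx : x ∈ Subgroup.closure (cs.simple '' J)) :
    ∃ ω : List B, (∀ i ∈ ω, i ∈ J) ∧ cs.wordProd ω = x := by
  induction hx using Subgroup.closure_induction with
  | mem x hx =>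
    obtain ⟨i, hi, rfl⟩ := hx
    exact ⟨[i], by simpa using hi, by simp⟩
  | one => exact ⟨[], by simp, by simp⟩
  | mul x y _ _ hx hy =>
    obtain ⟨a, ha, rfl⟩ := hx
    obtain ⟨b, hb, rfl⟩ := hy
    exact ⟨a ++ b, fun i hi => (List.mem_append.mp hi).elim (ha i) (hb i), cs.wordProd_append a b⟩
  | inv x _ hx =>
    obtain ⟨a, ha, rfl⟩ := hx
    exact ⟨a.reverse, by simpa using ha, cs.wordProd_reverse a⟩

theorem exists_isRightDescent_of_word {J : Set B} (ω : List B) (hJ : ∀ i ∈ ω, i ∈ J)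
    (hne : cs.wordProd ω ≠ 1) : ∃ i ∈ J, cs.IsRightDescent (cs.wordProd ω) i := by
  induction hn : ω.length using Nat.strong_induction_on generalizing ω with
  | _ n ih =>
    rcases ω.eq_nil_or_concat' with rfl | ⟨a, i, rfl⟩
    · simp at hne
    · by_cases hd : cs.IsRightDescent (cs.wordProd (a ++ [i])) i
      · exact ⟨i, hJ i (by simp), hd⟩
      · rw [wordProd_append, wordProd_singleton,
          ← cs.isRightDescent_iff_not_isRightDescent_mul] at hd
        obtain ⟨a', hsub, hlt, heq⟩ := cs.exists_sublist_wordProd_mul_simple hd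
        have heq' : cs.wordProd (a ++ [i]) = cs.wordProd a' := by
          rw [heq, wordProd_append, wordProd_singleton]
        rw [heq'] at hne ⊢
        refine ih a'.length ?_ a' (fun j hj => hJ j ?_) hne rfl
        · rw [← hn, List.length_append]; omega
        · exact List.mem_append_left _ (hsub.subset hj)

theorem exists_isRightDescent_of_mem_closure {J : Set B} {x : W}
    (hx : x ∈ Subgroup.closure (cs.simple '' J)) (hne : x ≠ 1) :
    ∃ i ∈ J, cs.IsRightDescent x i := by
  obtain ⟨ω, hJ, rfl⟩ := cs.exists_word_of_mem_closure hx
  exact cs.exists_isRightDescent_of_word ω hJ hne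

/-- Induction over a length-additive product `u * x` with `x` in a standard parabolic subgroup:
right descents of `x` in `J` are stripped off one at a time, until `u` is reached. -/
theorem parabolic_descent_induction {J : Set B} {u : W} {p : W → Prop}
    (step : ∀ w, ∀ i ∈ J, cs.IsRightDescent w i → p w → p (w * cs.simple i)) {x : W}
    (hx : x ∈ Subgroup.closure (cs.simple '' J))
    (hadd : cs.length (u * x) = cs.length u + cs.length x) (h : p (u * x)) : p u := by
  induction hn : cs.length x generalizing x with
  | zero =>
    rw [cs.length_eq_zero_iff.mp hn, mul_one] at h
    exact h
  | succ n ih =>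
    have hne : x ≠ 1 := by
      rintro rfl
      simp at hn
    obtain ⟨i, hi, hd⟩ := cs.exists_isRightDescent_of_mem_closure hx hne
    have hlen := cs.isRightDescent_iff.mp hd
    have hle := cs.length_mul_le u (x * cs.simple i)
    rw [← mul_assoc] at hle
    have hcases := cs.length_mul_simple (u * x) i
    refine ih (x := x * cs.simple i)
      (mul_mem hx (Subgroup.subset_closure (Set.mem_image_of_mem _ hi))) ?_ ?_ (by omega)
    · rw [← mul_assoc]
      omega
    · rw [← mul_assoc]
      exact step _ i hi (by rw [IsRightDescent]; omega) h

end CoxeterSystem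

/-- The projection `P^J : W → W^J` taking `w` to the `W^J`-factor of its length-additive
parabolic factorization `w = u·x` (`u ∈ W^J`, `x ∈ W_J`) is order-preserving for the
Bruhat order: if `w ≤ w'` then `u ≤ u'`.  (In particular, if `u ∈ W^J` and `w' ≥ u`,
then `u' ≥ u`.) -/
theorem parabolic_projection_bruhat_monotone
    {B W : Type*} [Group W] {M : CoxeterMatrix B} (cs : CoxeterSystem M W)
    (J : Set B) (w w' u u' x x' : W)
    (hw : w = u * x) (hw' : w' = u' * x')
    (hu : ∀ i ∈ J, ¬ cs.length (u * cs.simple i) < cs.length u)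
    (hu' : ∀ i ∈ J, ¬ cs.length (u' * cs.simple i) < cs.length u')
    (hx : x ∈ Subgroup.closure (cs.simple '' J))
    (hx' : x' ∈ Subgroup.closure (cs.simple '' J))
    (hadd : cs.length w = cs.length u + cs.length x)
    (hadd' : cs.length w' = cs.length u' + cs.length x')
    (hle : BruhatLE cs w w') :
    BruhatLE cs u u' := by
  subst hw hw'
  have hle' : BruhatLE cs u (u' * x') :=
    cs.parabolic_descent_induction (p := fun v => BruhatLE cs v (u' * x'))
      (fun _ _ _ hd h => h.mul_simple_left hd) hx hadd hle
  exact cs.parabolic_descent_induction (p := fun v => BruhatLE cs u v)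
    (fun _ i hi hd h => h.mul_simple_right (hu i hi) hd) hx' hadd' hle'
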